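/- Let F be a countably fan-tight filter on a set X, let Y be a set, and let R ⊆ X × Y. Then the image filter RF on Y is countably fan-tight. (In other words, the class F_1^† of countably fan-tight filters is F_1-composable.) -/

import Mathlib

open Filter Set

/-- Two filters mesh if all their members intersect, i.e. the filter generated by
pairwise intersections (which is `F ⊓ G` in Mathlib's order) is proper. -/
def Mesh {Z : Type*} (F G : Filter Z) : Prop := Filter.NeBot (F ⊓ G)

/-- The `†` relation on filters: `F † H` iff for every countable family of sets,
each meshing with `F ∨ H` (i.e. `F ⊓ H`), one can pick finite subsets whose union
meshes with `F ∨ H`. -/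
def Dagger {Z : Type*} (F H : Filter Z) : Prop :=
  ∀ A : ℕ → Set Z, (∀ n, Mesh (𝓟 (A n)) (F ⊓ H)) →
    ∃ B : ℕ → Set Z, (∀ n, B n ⊆ A n ∧ (B n).Finite) ∧ Mesh (𝓟 (⋃ n, B n)) (F ⊓ H)

/-- `F` is countably fan-tight: `F † A` for every subset `A` (i.e. `F ∈ F_1^†`). -/
def CountablyFanTight {Z : Type*} (F : Filter Z) : Prop :=
  ∀ A : Set Z, Dagger F (𝓟 A)

/-- The image filter `RF` of a filter `F` on `X` under a relation `R ⊆ X × Y`: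
generated by the sets `R(F) = {y | ∃ x ∈ F, (x, y) ∈ R}`. -/
def imgSet {X Y : Type*} (R : Set (X × Y)) (F : Filter X) : Filter Y :=
  ⨅ f ∈ F, 𝓟 {y | ∃ x ∈ f, (x, y) ∈ R}

theorem mesh_principal_inf_iff {Z : Type*} {G : Filter Z} {A C : Set Z} :
    Mesh (𝓟 C) (G ⊓ 𝓟 A) ↔ ∀ g ∈ G, (g ∩ (C ∩ A)).Nonempty := by
  rw [Mesh, inf_left_comm, inf_principal, inf_principal_neBot_iff]

theorem mem_imgSet {X Y : Type*} {R : Set (X × Y)} {F : Filter X} {s : Set Y} :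
    s ∈ imgSet R F ↔ ∃ f ∈ F, {y | ∃ x ∈ f, (x, y) ∈ R} ⊆ s :=
  mem_lift'_sets (h := fun f => {y | ∃ x ∈ f, (x, y) ∈ R})
    fun _ _ hfg _ ⟨x, hx, hxy⟩ => ⟨x, hfg hx, hxy⟩

theorem mesh_imgSet_iff {X Y : Type*} {R : Set (X × Y)} {F : Filter X} {A C : Set Y} :
    Mesh (𝓟 C) (imgSet R F ⊓ 𝓟 A) ↔
      Mesh (𝓟 {x | ∃ y ∈ C ∩ A, (x, y) ∈ R}) (F ⊓ 𝓟 univ) := by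
  simp only [mesh_principal_inf_iff, inter_univ]
  constructor
  · intro h f hf
    obtain ⟨y, ⟨x, hx, hxy⟩, hy⟩ := h _ (mem_imgSet.2 ⟨f, hf, Subset.rfl⟩)
    exact ⟨x, hx, y, hy, hxy⟩
  · intro h g hg
    obtain ⟨f, hf, hfg⟩ := mem_imgSet.1 hg
    obtain ⟨x, hx, y, hy, hxy⟩ := h f hf
    exact ⟨y, hfg ⟨x, hx, hxy⟩, hy⟩

theorem stmt9 {X Y : Type*} (F : Filter X) (hF : CountablyFanTight F)
    (R : Set (X × Y)) : CountablyFanTight (imgSet R F) := by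
  intro A C hC
  obtain ⟨B, hB, hmesh⟩ := hF univ _ fun n => mesh_imgSet_iff.1 (hC n)
  choose y hy hyR using fun n (x : B n) => (hB n).1 x.2
  refine ⟨fun n => range (y n), fun n => ⟨?_, ?_⟩, ?_⟩
  · rintro _ ⟨x, rfl⟩
    exact (hy n x).1
  · have := (hB n).2.to_subtype
    exact finite_range (y n)
  · rw [mesh_imgSet_iff]
    refine NeBot.mono hmesh (inf_le_inf_right _ (principal_mono.2 ?_))
    refine iUnion_subset fun n x hx => ?_
    exact ⟨y n ⟨x, hx⟩, ⟨mem_iUnion.2 ⟨n, mem_range_self _⟩, (hy n ⟨x, hx⟩).2⟩, hyR n ⟨x, hx⟩⟩
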